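/- Let s < s_0, 0 < q < ∞, 0 < r < ∞ and b > 0. Define K(t, x) as the K-functional of the couple (ℓ^s_q, ℓ^{s_0}_q). Then there exist constants c, C > 0, independent of the sequence x, such that c · ‖x‖_T ≤ (Σ_{j=0}^∞ [(1+j)^{b−1/r} K(2^{−j(s_0−s)}, x)]^r)^{1/r} ≤ C · ‖x‖_T, where ‖x‖_T = (Σ_{j=0}^∞ 2^{jbr} (Σ_{ν=2^j−1}^{2^{j+1}−2} (2^{νs}|x_ν|)^q)^{r/q})^{1/r}. -/

import Mathlib

open scoped ENNReal

/-- Quasi-norm of the weighted sequence space `ℓ^σ_q`. -/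
noncomputable def seqNorm (σ q : ℝ) (x : ℕ → ℝ) : ℝ≥0∞ :=
  (∑' ν : ℕ, ENNReal.ofReal (((2 : ℝ) ^ ((ν : ℝ) * σ) * |x ν|) ^ q)) ^ (1 / q)

/-- Peetre K-functional of the couple `(ℓ^s_q, ℓ^{s₀}_q)`. -/
noncomputable def seqK (s s₀ q t : ℝ) (x : ℕ → ℝ) : ℝ≥0∞ :=
  ⨅ d : {yz : (ℕ → ℝ) × (ℕ → ℝ) // ∀ ν, x ν = yz.1 ν + yz.2 ν},
    seqNorm s q d.val.1 + ENNReal.ofReal t * seqNorm s₀ q d.val.2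

lemma ENNReal.add_rpow_le_two_rpow_mul {q : ℝ} (hq : 0 < q) (a b : ℝ≥0∞) :
    (a + b) ^ q ≤ 2 ^ q * (a ^ q + b ^ q) := by
  have h : a + b ≤ 2 * max a b := by
    rw [two_mul]
    exact add_le_add (le_max_left _ _) (le_max_right _ _)
  refine (ENNReal.rpow_le_rpow h hq.le).trans ?_
  rw [ENNReal.mul_rpow_of_nonneg _ _ hq.le]
  gcongr
  rcases le_total a b with hab | hab
  · rw [max_eq_right hab]
    exact le_add_self
  · rw [max_eq_left hab]
    exact le_self_add

/-- The `q`-th power of the weighted `ν`-th entry of a sequence. -/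
noncomputable def seqTerm (σ q : ℝ) (x : ℕ → ℝ) (ν : ℕ) : ℝ≥0∞ :=
  ENNReal.ofReal (((2 : ℝ) ^ ((ν : ℝ) * σ) * |x ν|) ^ q)

lemma seqTerm_eq_rpow {q : ℝ} (hq : 0 < q) (σ : ℝ) (x : ℕ → ℝ) (ν : ℕ) :
    seqTerm σ q x ν = ENNReal.ofReal ((2 : ℝ) ^ ((ν : ℝ) * σ) * |x ν|) ^ q := by
  rw [seqTerm, ENNReal.ofReal_rpow_of_nonneg (by positivity) hq.le]

lemma seqNorm_rpow {q : ℝ} (hq : 0 < q) (σ : ℝ) (x : ℕ → ℝ) :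
    seqNorm σ q x ^ q = ∑' ν, seqTerm σ q x ν := by
  rw [seqNorm, ← ENNReal.rpow_mul, one_div_mul_cancel hq.ne', ENNReal.rpow_one]
  rfl

lemma seqTerm_le_of_eq_add {q : ℝ} (hq : 0 < q) (σ : ℝ) {x y z : ℕ → ℝ} {ν : ℕ}
    (h : x ν = y ν + z ν) :
    seqTerm σ q x ν ≤ 2 ^ q * (seqTerm σ q y ν + seqTerm σ q z ν) := by
  simp only [seqTerm_eq_rpow hq]
  refine (ENNReal.rpow_le_rpow ?_ hq.le).trans (ENNReal.add_rpow_le_two_rpow_mul hq _ _)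
  rw [← ENNReal.ofReal_add (by positivity) (by positivity), ← mul_add, h]
  gcongr
  exact abs_add_le _ _

lemma ofReal_rpow_mul_seqTerm {q : ℝ} (hq : 0 < q) (s s₀ : ℝ) (j : ℕ) (x : ℕ → ℝ) (ν : ℕ) :
    ENNReal.ofReal ((2 : ℝ) ^ (-(j : ℝ) * (s₀ - s))) ^ q * seqTerm s₀ q x ν =
      ENNReal.ofReal (((2 : ℝ) ^ ((s₀ - s) * q)) ^ ((ν : ℝ) - j)) * seqTerm s q x ν := by
  have h2 : (0 : ℝ) < 2 := two_pos
  rw [seqTerm, seqTerm, ENNReal.ofReal_rpow_of_nonneg (by positivity) hq.le,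
    ← ENNReal.ofReal_mul (by positivity), ← ENNReal.ofReal_mul (by positivity),
    Real.mul_rpow (by positivity) (by positivity), Real.mul_rpow (by positivity) (by positivity),
    ← mul_assoc, ← mul_assoc]
  simp only [← Real.rpow_mul h2.le, ← Real.rpow_add h2]
  ring_nf

lemma sum_seqTerm_le_seqK {s s₀ q : ℝ} (hs : s < s₀) (hq : 0 < q) (j : ℕ) (x : ℕ → ℝ)
    {S : Finset ℕ} (hS : ∀ ν ∈ S, j ≤ ν) :
    ∑ ν ∈ S, seqTerm s q x ν ≤
      2 ^ q * 2 * seqK s s₀ q ((2 : ℝ) ^ (-(j : ℝ) * (s₀ - s))) x ^ q := by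
  have hc0 : (2 : ℝ≥0∞) ^ q * 2 ≠ 0 := by simp
  have hct : (2 : ℝ≥0∞) ^ q * 2 ≠ ⊤ := by
    finiteness
  rw [mul_comm, ← ENNReal.div_le_iff hc0 hct]
  rw [← ENNReal.rpow_inv_le_iff hq]
  refine le_iInf fun ⟨⟨y, z⟩, h⟩ ↦ ?_
  rw [ENNReal.rpow_inv_le_iff hq, ENNReal.div_le_iff hc0 hct]
  set t := ENNReal.ofReal ((2 : ℝ) ^ (-(j : ℝ) * (s₀ - s))) with ht
  simp only at h ⊢
  have hy : ∑ ν ∈ S, seqTerm s q y ν ≤ (seqNorm s q y + t * seqNorm s₀ q z) ^ q := by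
    refine (ENNReal.sum_le_tsum S).trans ?_
    rw [← seqNorm_rpow hq]
    exact ENNReal.rpow_le_rpow le_self_add hq.le
  have hz : ∑ ν ∈ S, seqTerm s q z ν ≤ (seqNorm s q y + t * seqNorm s₀ q z) ^ q := by
    calc ∑ ν ∈ S, seqTerm s q z ν ≤ ∑ ν ∈ S, t ^ q * seqTerm s₀ q z ν := by
          refine Finset.sum_le_sum fun ν hν ↦ ?_
          rw [ofReal_rpow_mul_seqTerm hq]
          refine le_mul_of_one_le_left' ?_
          rw [ENNReal.one_le_ofReal]
          refine Real.one_le_rpow (Real.one_le_rpow one_le_two ?_) ?_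
          · exact mul_nonneg (sub_nonneg.2 hs.le) hq.le
          · exact sub_nonneg.2 (by exact_mod_cast hS ν hν)
      _ ≤ ∑' ν, t ^ q * seqTerm s₀ q z ν := ENNReal.sum_le_tsum S
      _ = (t * seqNorm s₀ q z) ^ q := by
          rw [ENNReal.tsum_mul_left, ← seqNorm_rpow hq, ENNReal.mul_rpow_of_nonneg _ _ hq.le]
      _ ≤ _ := ENNReal.rpow_le_rpow le_add_self hq.le
  calc ∑ ν ∈ S, seqTerm s q x ν
      ≤ ∑ ν ∈ S, 2 ^ q * (seqTerm s q y ν + seqTerm s q z ν) :=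
        Finset.sum_le_sum fun ν _ ↦ seqTerm_le_of_eq_add hq s (h ν)
    _ = 2 ^ q * (∑ ν ∈ S, seqTerm s q y ν + ∑ ν ∈ S, seqTerm s q z ν) := by
        rw [← Finset.mul_sum, Finset.sum_add_distrib]
    _ ≤ 2 ^ q * ((seqNorm s q y + t * seqNorm s₀ q z) ^ q +
          (seqNorm s q y + t * seqNorm s₀ q z) ^ q) := by gcongr
    _ = _ := by ring

lemma seqK_rpow_le_tsum {q : ℝ} (hq : 0 < q) (s s₀ : ℝ) (j : ℕ) (x : ℕ → ℝ) :
    seqK s s₀ q ((2 : ℝ) ^ (-(j : ℝ) * (s₀ - s))) x ^ q ≤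
      2 ^ q * ∑' ν, ENNReal.ofReal (((2 : ℝ) ^ (-((s₀ - s) * q))) ^ (j - ν)) *
        seqTerm s q x ν := by
  let y : ℕ → ℝ := fun ν ↦ if j ≤ ν then x ν else 0
  let z : ℕ → ℝ := fun ν ↦ if j ≤ ν then 0 else x ν
  have hyz : ∀ ν, x ν = y ν + z ν := fun ν ↦ by
    by_cases h : j ≤ ν <;> simp [y, z, h]
  have hK : seqK s s₀ q ((2 : ℝ) ^ (-(j : ℝ) * (s₀ - s))) x ≤ _ := iInf_le _ ⟨(y, z), hyz⟩
  refine (ENNReal.rpow_le_rpow hK hq.le).trans ?_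
  refine (ENNReal.add_rpow_le_two_rpow_mul hq _ _).trans ?_
  gcongr
  rw [ENNReal.mul_rpow_of_nonneg _ _ hq.le, seqNorm_rpow hq, seqNorm_rpow hq,
    ← ENNReal.tsum_mul_left, ← ENNReal.tsum_add]
  refine ENNReal.tsum_le_tsum fun ν ↦ ?_
  rw [ofReal_rpow_mul_seqTerm hq]
  by_cases h : j ≤ ν
  · have hz : seqTerm s q z ν = 0 := by simp [seqTerm, z, h, Real.zero_rpow hq.ne']
    have hy : seqTerm s q y ν = seqTerm s q x ν := by simp [seqTerm, y, h]
    simp [hz, hy, Nat.sub_eq_zero_of_le h]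
  · have hz : seqTerm s q z ν = seqTerm s q x ν := by simp [seqTerm, z, h]
    have hy : seqTerm s q y ν = 0 := by simp [seqTerm, y, h, Real.zero_rpow hq.ne']
    rw [hz, hy, zero_add, ← Real.rpow_natCast, Nat.cast_sub (not_le.1 h).le,
      ← Real.rpow_mul two_pos.le, ← Real.rpow_mul two_pos.le]
    apply le_of_eq
    ring_nf

/-- The dyadic block `{2^k - 1, …, 2^(k+1) - 2}`. -/
abbrev dyadicBlock (k : ℕ) : Finset ℕ := Finset.Icc (2 ^ k - 1) (2 ^ (k + 1) - 2)

lemma mem_dyadicBlock {j k : ℕ} :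
    j ∈ dyadicBlock k ↔ 2 ^ k ≤ j + 1 ∧ j + 1 < 2 ^ (k + 1) := by
  rw [Finset.mem_Icc]
  have h1 : 1 ≤ 2 ^ k := Nat.one_le_two_pow
  rw [pow_succ]
  omega

lemma mem_dyadicBlock_iff_log {j k : ℕ} : j ∈ dyadicBlock k ↔ k = Nat.log 2 (j + 1) := by
  rw [mem_dyadicBlock, eq_comm, Nat.log_eq_iff (Or.inr ⟨one_lt_two, j.succ_ne_zero⟩)]

lemma card_dyadicBlock (k : ℕ) : (dyadicBlock k).card = 2 ^ k := by
  rw [Nat.card_Icc]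
  have h1 : 1 ≤ 2 ^ k := Nat.one_le_two_pow
  rw [pow_succ]
  omega

lemma tsum_eq_tsum_dyadicBlock (f : ℕ → ℝ≥0∞) :
    ∑' j, f j = ∑' k : ℕ, ∑ j ∈ dyadicBlock k, f j := by
  have h (k : ℕ) : ∑ j ∈ dyadicBlock k, f j =
      ∑' j, if k = Nat.log 2 (j + 1) then f j else 0 := by
    rw [tsum_eq_sum (s := dyadicBlock k)]
    · exact Finset.sum_congr rfl fun j hj ↦ (if_pos (mem_dyadicBlock_iff_log.1 hj)).symm
    · exact fun j hj ↦ if_neg fun hk ↦ hj (mem_dyadicBlock_iff_log.2 hk)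
  simp_rw [h]
  rw [ENNReal.tsum_comm]
  simp

lemma one_add_rpow_mem_dyadicBlock {j k : ℕ} (hj : j ∈ dyadicBlock k) (e : ℝ) :
    (2 : ℝ) ^ (-|e|) * 2 ^ ((k : ℝ) * e) ≤ (1 + (j : ℝ)) ^ e ∧
      (1 + (j : ℝ)) ^ e ≤ 2 ^ |e| * 2 ^ ((k : ℝ) * e) := by
  obtain ⟨h1, h2⟩ := mem_dyadicBlock.1 hj
  have h1' : (2 : ℝ) ^ k ≤ 1 + j := by rw [add_comm]; exact_mod_cast h1
  have h2' : 1 + (j : ℝ) ≤ 2 * 2 ^ k := by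
    rw [add_comm, ← pow_succ']; exact_mod_cast h2.le
  have hk : (0 : ℝ) < 2 ^ k := by positivity
  obtain ⟨u, hu⟩ : ∃ u : ℝ, 1 + (j : ℝ) = u * 2 ^ k := ⟨(1 + j) / 2 ^ k, by field_simp⟩
  have hu1 : 1 ≤ u := by rw [hu] at h1'; nlinarith
  have hu2 : u ≤ 2 := by rw [hu] at h2'; nlinarith
  rw [hu, Real.mul_rpow (by positivity) hk.le, ← Real.rpow_natCast, ← Real.rpow_mul two_pos.le]
  constructor
  · gcongr
    calc (2 : ℝ) ^ (-|e|) ≤ u ^ (-|e|) :=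
          Real.rpow_le_rpow_of_nonpos (by positivity) hu2 (by simp)
      _ ≤ u ^ e := Real.rpow_le_rpow_of_exponent_le hu1 (neg_abs_le e)
  · gcongr
    calc u ^ e ≤ u ^ |e| := Real.rpow_le_rpow_of_exponent_le hu1 (le_abs_self e)
      _ ≤ 2 ^ |e| := Real.rpow_le_rpow (by positivity) hu2 (abs_nonneg e)

lemma tsum_int_pow_natAbs_ne_top {ρ : ℝ≥0∞} (hρ : ρ < 1) : ∑' n : ℤ, ρ ^ n.natAbs ≠ ⊤ := by
  have h : ∑' n : ℕ, ρ ^ n ≠ ⊤ := by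
    rw [ENNReal.tsum_geometric]
    exact ENNReal.inv_ne_top.2 (tsub_pos_of_lt hρ).ne'
  rw [tsum_of_nat_of_neg_add_one ENNReal.summable ENNReal.summable]
  refine ENNReal.add_ne_top.2 ⟨by simpa using h, ne_top_of_le_ne_top h ?_⟩
  refine ENNReal.tsum_le_tsum fun n ↦ ?_
  exact pow_le_pow_right_of_le_one' hρ.le (by omega)

lemma tsum_tsum_pow_natAbs_mul_rpow_le {ρ : ℝ≥0∞} (hρ : ρ < 1) {p : ℝ} (hp : 0 < p) :
    ∃ C : ℝ≥0∞, C ≠ ⊤ ∧ ∀ B : ℕ → ℝ≥0∞,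
      ∑' k : ℕ, (∑' m : ℕ, ρ ^ ((k : ℤ) - m).natAbs * B m) ^ p ≤ C * ∑' m, B m ^ p := by
  obtain ⟨τ, hτ, rfl⟩ : ∃ τ < 1, ρ = τ * τ := by
    refine ⟨ρ ^ (1 / 2 : ℝ), ENNReal.rpow_lt_one hρ (by norm_num), ?_⟩
    rw [← ENNReal.rpow_add_of_nonneg _ _ (by norm_num) (by norm_num)]
    norm_num
  have hτp : τ ^ p < 1 := ENNReal.rpow_lt_one hτ hp
  have hsub (k : ℕ) : Function.Injective fun m : ℕ ↦ (k : ℤ) - m := fun a b h ↦ by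
    simpa using h
  have hsub' (m : ℕ) : Function.Injective fun k : ℕ ↦ (k : ℤ) - m := fun a b h ↦ by
    simpa using h
  refine ⟨(∑' n : ℤ, τ ^ n.natAbs) ^ p * ∑' n : ℤ, (τ ^ p) ^ n.natAbs, ?_, fun B ↦ ?_⟩
  · exact ENNReal.mul_ne_top
      (ENNReal.rpow_ne_top_of_nonneg hp.le (tsum_int_pow_natAbs_ne_top hτ))
      (tsum_int_pow_natAbs_ne_top hτp)
  have key (k : ℕ) : (∑' m : ℕ, (τ * τ) ^ ((k : ℤ) - m).natAbs * B m) ^ p ≤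
      (∑' n : ℤ, τ ^ n.natAbs) ^ p *
        ∑' m : ℕ, (τ ^ p) ^ ((k : ℤ) - m).natAbs * B m ^ p := by
    set N := ∑' m : ℕ, (τ ^ p) ^ ((k : ℤ) - m).natAbs * B m ^ p with hN
    have hle (m : ℕ) : τ ^ ((k : ℤ) - m).natAbs * B m ≤ N ^ p⁻¹ := by
      rw [ENNReal.le_rpow_inv_iff hp, ENNReal.mul_rpow_of_nonneg _ _ hp.le,
        ← ENNReal.rpow_natCast, ← ENNReal.rpow_mul, mul_comm _ p, ENNReal.rpow_mul,
        ENNReal.rpow_natCast]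
      exact ENNReal.le_tsum m
    calc (∑' m : ℕ, (τ * τ) ^ ((k : ℤ) - m).natAbs * B m) ^ p
        ≤ (∑' m : ℕ, τ ^ ((k : ℤ) - m).natAbs * N ^ p⁻¹) ^ p := by
          refine ENNReal.rpow_le_rpow (ENNReal.tsum_le_tsum fun m ↦ ?_) hp.le
          rw [mul_pow, mul_assoc]
          gcongr
          exact hle m
      _ ≤ ((∑' n : ℤ, τ ^ n.natAbs) * N ^ p⁻¹) ^ p := by
          rw [ENNReal.tsum_mul_right]
          gcongr
          exact ENNReal.tsum_comp_le_tsum_of_injective (hsub k) fun n : ℤ ↦ τ ^ n.natAbs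
      _ = (∑' n : ℤ, τ ^ n.natAbs) ^ p * N := by
          rw [ENNReal.mul_rpow_of_nonneg _ _ hp.le, ENNReal.rpow_inv_rpow hp.ne']
  refine (ENNReal.tsum_le_tsum key).trans ?_
  rw [ENNReal.tsum_mul_left, ENNReal.tsum_comm, mul_assoc]
  gcongr
  rw [← ENNReal.tsum_mul_left]
  refine ENNReal.tsum_le_tsum fun m ↦ ?_
  rw [ENNReal.tsum_mul_right]
  gcongr
  exact ENNReal.tsum_comp_le_tsum_of_injective (hsub' m) fun n : ℤ ↦ (τ ^ p) ^ n.natAbs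

lemma exists_pow_mul_rpow_le {θ : ℝ} (hθ : 0 < θ) (hθ1 : θ < 1) (N : ℝ) :
    ∃ C : ℝ, 0 < C ∧ ∀ n : ℕ, θ ^ n * ((n : ℝ) + 1) ^ N ≤ C := by
  obtain ⟨M, hM⟩ := exists_nat_ge N
  have h := ((tendsto_pow_const_mul_const_pow_of_lt_one M hθ.le hθ1).comp
    (Filter.tendsto_add_atTop_nat 1)).bddAbove_range
  obtain ⟨C, hC⟩ := h
  have hC' (n : ℕ) : ((n : ℝ) + 1) ^ M * θ ^ (n + 1) ≤ C := by
    simpa using hC ⟨n, rfl⟩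
  have hC0 : 0 < C := lt_of_lt_of_le (by positivity) (hC' 0)
  refine ⟨C / θ, by positivity, fun n ↦ ?_⟩
  rw [le_div_iff₀ hθ]
  refine le_trans ?_ (hC' n)
  have : ((n : ℝ) + 1) ^ N ≤ ((n : ℝ) + 1) ^ M := by
    rw [← Real.rpow_natCast]
    exact Real.rpow_le_rpow_of_exponent_le (by simp) hM
  calc θ ^ n * ((n : ℝ) + 1) ^ N * θ = ((n : ℝ) + 1) ^ N * θ ^ (n + 1) := by ring
    _ ≤ _ := by gcongr

lemma exists_pow_tsub_le_dyadicBlock {θ : ℝ} (hθ : 0 < θ) (hθ1 : θ < 1) {β : ℝ} (hβ : 0 < β) :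
    ∃ C : ℝ, 0 < C ∧ ∀ k m j ν : ℕ, j ∈ dyadicBlock k → ν ∈ dyadicBlock m →
      θ ^ (j - ν) ≤ C * 2 ^ (-((k : ℝ) * β)) * 2 ^ ((m : ℝ) * β) *
        ((2 : ℝ) ^ (-β)) ^ ((k : ℤ) - m).natAbs := by
  obtain ⟨C, hC0, hC⟩ := exists_pow_mul_rpow_le hθ hθ1 (2 * β)
  have h2 : (0 : ℝ) < 2 := two_pos
  refine ⟨1 + C * 2 ^ (2 * β), by positivity, fun k m j ν hj hν ↦ ?_⟩
  rw [← Real.rpow_natCast (2 ^ (-β)), ← Real.rpow_mul h2.le, mul_assoc, mul_assoc,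
    ← Real.rpow_add h2, ← Real.rpow_add h2]
  rcases le_total k m with hkm | hkm
  · have : ((((k : ℤ) - m).natAbs : ℕ) : ℝ) = m - k := by
      rw [← Nat.cast_sub (R := ℝ) hkm, Nat.cast_inj]; omega
    rw [this, show -((k : ℝ) * β) + (m * β + -β * (m - k)) = 0 by ring, Real.rpow_zero, mul_one]
    refine (pow_le_one₀ hθ.le hθ1.le).trans ?_
    exact le_add_of_nonneg_right (by positivity)
  · have : ((((k : ℤ) - m).natAbs : ℕ) : ℝ) = k - m := by
      rw [← Nat.cast_sub (R := ℝ) hkm, Nat.cast_inj]; omega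
    rw [this]
    have hjk : (2 : ℝ) ^ k ≤ j + 1 := by exact_mod_cast (mem_dyadicBlock.1 hj).1
    have hνm : (ν : ℝ) + 1 ≤ 2 ^ (m + 1) := by exact_mod_cast (mem_dyadicBlock.1 hν).2.le
    have hprod : (j : ℝ) + 1 ≤ (ν + 1) * (((j - ν : ℕ) : ℝ) + 1) := by
      have : j ≤ ν + (j - ν) := by omega
      have h' : j + 1 ≤ (ν + 1) * ((j - ν) + 1) := by
        nlinarith [Nat.zero_le (ν * (j - ν))]
      exact_mod_cast h'
    have hpow : (2 : ℝ) ^ ((k - m - 1 : ℝ) * (2 * β)) ≤ (((j - ν : ℕ) : ℝ) + 1) ^ (2 * β) := by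
      rw [Real.rpow_mul h2.le]
      refine Real.rpow_le_rpow (by positivity) ?_ (by positivity)
      rw [show (k - m - 1 : ℝ) = k - (m + 1 : ℕ) by push_cast; ring, Real.rpow_sub h2,
        Real.rpow_natCast, Real.rpow_natCast, div_le_iff₀ (by positivity)]
      calc (2 : ℝ) ^ k ≤ (ν + 1) * (((j - ν : ℕ) : ℝ) + 1) := hjk.trans hprod
        _ ≤ 2 ^ (m + 1) * (((j - ν : ℕ) : ℝ) + 1) := by gcongr
        _ = _ := mul_comm _ _
    have hle : θ ^ (j - ν) * 2 ^ ((k - m - 1 : ℝ) * (2 * β)) ≤ C :=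
      (mul_le_mul_of_nonneg_left hpow (by positivity)).trans (hC _)
    rw [← le_div_iff₀ (by positivity), div_eq_mul_inv, ← Real.rpow_neg h2.le] at hle
    refine hle.trans ?_
    rw [show -((k - m - 1 : ℝ) * (2 * β)) =
      2 * β + (-((k : ℝ) * β) + (m * β + -β * (k - m))) by ring, Real.rpow_add h2, ← mul_assoc]
    gcongr
    exact le_add_of_nonneg_left zero_le_one

/-- The sum of the weighted entries of `x` over a dyadic block. -/
noncomputable def blockSum (s q : ℝ) (x : ℕ → ℝ) (k : ℕ) : ℝ≥0∞ :=
  ∑ ν ∈ dyadicBlock k, seqTerm s q x ν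

lemma exists_seqK_rpow_le_tsum_blockSum {s s₀ q β : ℝ} (hs : s < s₀) (hq : 0 < q) (hβ : 0 < β) :
    ∃ C : ℝ≥0∞, C ≠ ⊤ ∧ ∀ (x : ℕ → ℝ) (k j : ℕ), j ∈ dyadicBlock k →
      seqK s s₀ q ((2 : ℝ) ^ (-(j : ℝ) * (s₀ - s))) x ^ q ≤
        C * ENNReal.ofReal (2 ^ (-((k : ℝ) * β))) *
          ∑' m : ℕ, ENNReal.ofReal (2 ^ (-β)) ^ ((k : ℤ) - m).natAbs *
            (ENNReal.ofReal (2 ^ ((m : ℝ) * β)) * blockSum s q x m) := by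
  have hθ1 : (2 : ℝ) ^ (-((s₀ - s) * q)) < 1 :=
    Real.rpow_lt_one_of_one_lt_of_neg one_lt_two
      (neg_lt_zero.2 (mul_pos (sub_pos.2 hs) hq))
  obtain ⟨C, hC0, hC⟩ := exists_pow_tsub_le_dyadicBlock (Real.rpow_pos_of_pos two_pos _) hθ1 hβ
  refine ⟨2 ^ q * ENNReal.ofReal C, by finiteness, fun x k j hj ↦ ?_⟩
  refine (seqK_rpow_le_tsum hq s s₀ j x).trans ?_
  rw [tsum_eq_tsum_dyadicBlock, mul_assoc, mul_assoc]
  gcongr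
  rw [← ENNReal.tsum_mul_left, ← ENNReal.tsum_mul_left]
  refine ENNReal.tsum_le_tsum fun m ↦ ?_
  rw [blockSum, Finset.mul_sum, Finset.mul_sum, Finset.mul_sum, Finset.mul_sum]
  refine Finset.sum_le_sum fun ν hν ↦ ?_
  refine (mul_le_mul_left (ENNReal.ofReal_le_ofReal (hC k m j ν hj hν)) _).trans_eq ?_
  rw [ENNReal.ofReal_mul (by positivity), ENNReal.ofReal_mul (by positivity),
    ENNReal.ofReal_mul (by positivity), ENNReal.ofReal_pow (by positivity)]
  ring

lemma exists_tsum_seqK_le {s s₀ q r b : ℝ} (hs : s < s₀) (hq : 0 < q) (hr : 0 < r)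
    (hb : 0 < b) :
    ∃ C : ℝ≥0∞, C ≠ ⊤ ∧ ∀ x : ℕ → ℝ,
      ∑' j : ℕ, ENNReal.ofReal ((1 + (j : ℝ)) ^ ((b - 1 / r) * r)) *
          seqK s s₀ q ((2 : ℝ) ^ (-(j : ℝ) * (s₀ - s))) x ^ r ≤
        C * ∑' k : ℕ, ENNReal.ofReal ((2 : ℝ) ^ ((k : ℝ) * b * r)) *
          blockSum s q x k ^ (r / q) := by
  have hp : 0 < r / q := div_pos hr hq
  have hβ : 0 < b * q := mul_pos hb hq
  obtain ⟨C₁, hC₁, h₁⟩ := exists_seqK_rpow_le_tsum_blockSum hs hq hβ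
  have hρ : ENNReal.ofReal (2 ^ (-(b * q))) < 1 := by
    rw [ENNReal.ofReal_lt_one]
    exact Real.rpow_lt_one_of_one_lt_of_neg one_lt_two (neg_lt_zero.2 hβ)
  obtain ⟨C₂, hC₂, h₂⟩ := tsum_tsum_pow_natAbs_mul_rpow_le hρ hp
  set e := (b - 1 / r) * r with he
  have he' : e = b * r - 1 := by rw [he]; field_simp
  refine ⟨ENNReal.ofReal (2 ^ |e|) * C₁ ^ (r / q) * C₂, ?_, fun x ↦ ?_⟩
  · have := ENNReal.rpow_ne_top_of_nonneg hp.le hC₁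
    finiteness
  let B : ℕ → ℝ≥0∞ := fun m ↦ ENNReal.ofReal (2 ^ ((m : ℝ) * (b * q))) * blockSum s q x m
  have hB (m : ℕ) : B m ^ (r / q) =
      ENNReal.ofReal ((2 : ℝ) ^ ((m : ℝ) * b * r)) * blockSum s q x m ^ (r / q) := by
    rw [ENNReal.mul_rpow_of_nonneg _ _ hp.le, ENNReal.ofReal_rpow_of_nonneg (by positivity) hp.le,
      ← Real.rpow_mul two_pos.le,
      show (m : ℝ) * (b * q) * (r / q) = m * b * r by field_simp]
  have hblock (k : ℕ) : ∑ j ∈ dyadicBlock k, ENNReal.ofReal ((1 + (j : ℝ)) ^ e) *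
        seqK s s₀ q ((2 : ℝ) ^ (-(j : ℝ) * (s₀ - s))) x ^ r ≤
      ENNReal.ofReal (2 ^ |e|) * C₁ ^ (r / q) * (∑' m : ℕ,
        ENNReal.ofReal (2 ^ (-(b * q))) ^ ((k : ℤ) - m).natAbs * B m) ^ (r / q) := by
    set S := ∑' m : ℕ, ENNReal.ofReal (2 ^ (-(b * q))) ^ ((k : ℤ) - m).natAbs * B m with hS
    calc _ ≤ ∑ j ∈ dyadicBlock k, ENNReal.ofReal (2 ^ |e| * 2 ^ ((k : ℝ) * e)) *
          (C₁ * ENNReal.ofReal (2 ^ (-((k : ℝ) * (b * q)))) * S) ^ (r / q) := by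
          refine Finset.sum_le_sum fun j hj ↦ mul_le_mul'
            (ENNReal.ofReal_le_ofReal (one_add_rpow_mem_dyadicBlock hj e).2) ?_
          rw [show seqK s s₀ q ((2 : ℝ) ^ (-(j : ℝ) * (s₀ - s))) x ^ r =
            (seqK s s₀ q ((2 : ℝ) ^ (-(j : ℝ) * (s₀ - s))) x ^ q) ^ (r / q) by
              rw [← ENNReal.rpow_mul, mul_div_cancel₀ _ hq.ne']]
          exact ENNReal.rpow_le_rpow (h₁ x k j hj) hp.le
      _ = ENNReal.ofReal (2 ^ |e|) * C₁ ^ (r / q) * S ^ (r / q) *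
          ENNReal.ofReal (2 ^ k * 2 ^ ((k : ℝ) * e) * 2 ^ (-((k : ℝ) * (b * r)))) := by
          rw [Finset.sum_const, card_dyadicBlock, nsmul_eq_mul,
            ENNReal.mul_rpow_of_nonneg _ _ hp.le, ENNReal.mul_rpow_of_nonneg _ _ hp.le,
            ENNReal.ofReal_rpow_of_nonneg (by positivity) hp.le, ← Real.rpow_mul two_pos.le,
            show -((k : ℝ) * (b * q)) * (r / q) = -(k * (b * r)) by field_simp,
            ENNReal.ofReal_mul (by positivity), ENNReal.ofReal_mul (by positivity),
            ENNReal.ofReal_mul (by positivity), ENNReal.ofReal_pow two_pos.le]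
          push_cast
          rw [ENNReal.ofReal_ofNat]
          ring
      _ = _ := by
          rw [← Real.rpow_natCast, ← Real.rpow_add two_pos, ← Real.rpow_add two_pos, he',
            show (k : ℝ) + k * (b * r - 1) + -(k * (b * r)) = 0 by ring]
          simp
  rw [tsum_eq_tsum_dyadicBlock]
  refine (ENNReal.tsum_le_tsum hblock).trans ?_
  rw [ENNReal.tsum_mul_left, mul_assoc _ C₂]
  simp_rw [← hB]
  gcongr
  exact h₂ B

lemma blockSum_zero (s q : ℝ) (x : ℕ → ℝ) : blockSum s q x 0 = seqTerm s q x 0 := by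
  simp [blockSum, dyadicBlock]

lemma exists_tsum_blockSum_le {s s₀ q r b : ℝ} (hs : s < s₀) (hq : 0 < q) (hr : 0 < r) :
    ∃ C : ℝ≥0∞, C ≠ ⊤ ∧ ∀ x : ℕ → ℝ,
      ∑' k : ℕ, ENNReal.ofReal ((2 : ℝ) ^ ((k : ℝ) * b * r)) * blockSum s q x k ^ (r / q) ≤
        C * ∑' j : ℕ, ENNReal.ofReal ((1 + (j : ℝ)) ^ ((b - 1 / r) * r)) *
          seqK s s₀ q ((2 : ℝ) ^ (-(j : ℝ) * (s₀ - s))) x ^ r := by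
  have hp : 0 < r / q := div_pos hr hq
  set e := (b - 1 / r) * r with he
  have he' : e = b * r - 1 := by rw [he]; field_simp
  set D : ℝ≥0∞ := (2 ^ q * 2) ^ (r / q) with hD
  have hDt : D ≠ ⊤ := ENNReal.rpow_ne_top_of_nonneg hp.le (by finiteness)
  refine ⟨D + D * ENNReal.ofReal (2 ^ (b * r + |e|)), by finiteness, fun x ↦ ?_⟩
  set K : ℕ → ℝ≥0∞ := fun j ↦ seqK s s₀ q ((2 : ℝ) ^ (-(j : ℝ) * (s₀ - s))) x with hK
  have hblock {j k : ℕ} (h : ∀ ν ∈ dyadicBlock k, j ≤ ν) :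
      blockSum s q x k ^ (r / q) ≤ D * K j ^ r := by
    refine (ENNReal.rpow_le_rpow (sum_seqTerm_le_seqK hs hq j x h) hp.le).trans_eq ?_
    rw [ENNReal.mul_rpow_of_nonneg _ _ hp.le, ← ENNReal.rpow_mul, mul_div_cancel₀ _ hq.ne']
  rw [tsum_eq_zero_add' ENNReal.summable, add_mul]
  refine add_le_add ?_ ?_
  · calc _ ≤ D * K 0 ^ r := by simpa using hblock (j := 0) (k := 0) (by simp)
      _ ≤ _ := by
        gcongr
        refine le_trans ?_ (ENNReal.le_tsum 0)
        simp [hK]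
  · rw [tsum_eq_tsum_dyadicBlock fun j ↦ ENNReal.ofReal ((1 + (j : ℝ)) ^ e) * K j ^ r,
      ← ENNReal.tsum_mul_left]
    refine ENNReal.tsum_le_tsum fun k ↦ ?_
    have hreal : (2 : ℝ) ^ (((k + 1 : ℕ) : ℝ) * b * r) =
        2 ^ (b * r + |e|) * (2 ^ k * (2 ^ (-|e|) * 2 ^ ((k : ℝ) * e))) := by
      rw [← Real.rpow_natCast, ← Real.rpow_add two_pos, ← Real.rpow_add two_pos,
        ← Real.rpow_add two_pos, he']
      push_cast
      ring_nf
    set A := blockSum s q x (k + 1) ^ (r / q) with hA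
    calc ENNReal.ofReal ((2 : ℝ) ^ (((k + 1 : ℕ) : ℝ) * b * r)) * A
        = ENNReal.ofReal (2 ^ (b * r + |e|)) *
            ∑ j ∈ dyadicBlock k, ENNReal.ofReal (2 ^ (-|e|) * 2 ^ ((k : ℝ) * e)) * A := by
          rw [hreal, Finset.sum_const, card_dyadicBlock, nsmul_eq_mul,
            ENNReal.ofReal_mul (by positivity), ENNReal.ofReal_mul (by positivity),
            ENNReal.ofReal_pow two_pos.le]
          push_cast
          rw [ENNReal.ofReal_ofNat]
          ring
      _ ≤ ENNReal.ofReal (2 ^ (b * r + |e|)) *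
            ∑ j ∈ dyadicBlock k, ENNReal.ofReal ((1 + (j : ℝ)) ^ e) * (D * K j ^ r) := by
          gcongr with j hj
          · exact (one_add_rpow_mem_dyadicBlock hj e).1
          · refine hblock fun ν hν ↦ ?_
            have h1 := (mem_dyadicBlock.1 hj).2
            have h2 := (mem_dyadicBlock.1 hν).1
            omega
      _ = _ := by
          rw [Finset.mul_sum, Finset.mul_sum]
          exact Finset.sum_congr rfl fun j _ ↦ by ring

lemma exists_rpow_le_ofReal_mul_rpow {C : ℝ≥0∞} (hC : C ≠ ⊤) {p : ℝ} (hp : 0 ≤ p) :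
    ∃ c : ℝ, 0 < c ∧ ∀ a b : ℝ≥0∞, a ≤ C * b → a ^ p ≤ ENNReal.ofReal c * b ^ p := by
  refine ⟨(C ^ p).toReal + 1, by positivity, fun a b h ↦ ?_⟩
  refine (ENNReal.rpow_le_rpow h hp).trans ?_
  rw [ENNReal.mul_rpow_of_nonneg _ _ hp]
  gcongr
  rw [ENNReal.le_ofReal_iff_toReal_le (ENNReal.rpow_ne_top_of_nonneg hp hC) (by positivity)]
  exact le_add_of_nonneg_right zero_le_one

lemma exists_ofReal_mul_rpow_le {C : ℝ≥0∞} (hC : C ≠ ⊤) {p : ℝ} (hp : 0 ≤ p) :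
    ∃ c : ℝ, 0 < c ∧ ∀ a b : ℝ≥0∞, a ≤ C * b → ENNReal.ofReal c * a ^ p ≤ b ^ p := by
  obtain ⟨c, hc, h⟩ := exists_rpow_le_ofReal_mul_rpow hC hp
  refine ⟨c⁻¹, by positivity, fun a b hab ↦ ?_⟩
  calc ENNReal.ofReal c⁻¹ * a ^ p ≤ ENNReal.ofReal c⁻¹ * (ENNReal.ofReal c * b ^ p) :=
        mul_le_mul_right (h a b hab) _
    _ = b ^ p := by
      rw [← mul_assoc, ← ENNReal.ofReal_mul (by positivity), inv_mul_cancel₀ hc.ne',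
        ENNReal.ofReal_one, one_mul]

/-- For `s < s₀`, `b > 0`: the limiting interpolation quasi-norm
`(Σ_j [(1+j)^{b-1/r} K(2^{-j(s₀-s)}, x)]^r)^{1/r}` is equivalent to the truncated
quasi-norm `(Σ_j 2^{jbr} (Σ_{ν ∈ I_j} (2^{νs}|x_ν|)^q)^{r/q})^{1/r}` built from the
dyadic blocks `I_j = {2^j-1, …, 2^{j+1}-2}`. -/
theorem limiting_interpolation_eq_truncated_pos (s s₀ q r b : ℝ) (hs : s < s₀)
    (hq : 0 < q) (hr : 0 < r) (hb : 0 < b) :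
    ∃ c C : ℝ, 0 < c ∧ 0 < C ∧
      ∀ x : ℕ → ℝ,
        (ENNReal.ofReal c *
            (∑' j : ℕ, ENNReal.ofReal ((2 : ℝ) ^ ((j : ℝ) * b * r)) *
              (∑ ν ∈ Finset.Icc (2 ^ j - 1 : ℕ) (2 ^ (j + 1) - 2),
                ENNReal.ofReal (((2 : ℝ) ^ ((ν : ℝ) * s) * |x ν|) ^ q)) ^ (r / q)) ^ (1 / r) ≤
          (∑' j : ℕ, ENNReal.ofReal ((1 + (j : ℝ)) ^ ((b - 1 / r) * r)) *
            (seqK s s₀ q ((2 : ℝ) ^ (-(j : ℝ) * (s₀ - s))) x) ^ r) ^ (1 / r)) ∧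
        ((∑' j : ℕ, ENNReal.ofReal ((1 + (j : ℝ)) ^ ((b - 1 / r) * r)) *
            (seqK s s₀ q ((2 : ℝ) ^ (-(j : ℝ) * (s₀ - s))) x) ^ r) ^ (1 / r) ≤
          ENNReal.ofReal C *
            (∑' j : ℕ, ENNReal.ofReal ((2 : ℝ) ^ ((j : ℝ) * b * r)) *
              (∑ ν ∈ Finset.Icc (2 ^ j - 1 : ℕ) (2 ^ (j + 1) - 2),
                ENNReal.ofReal (((2 : ℝ) ^ ((ν : ℝ) * s) * |x ν|) ^ q)) ^ (r / q)) ^ (1 / r)) := by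
  obtain ⟨C₁, hC₁, h₁⟩ := exists_tsum_blockSum_le (b := b) hs hq hr
  obtain ⟨C₂, hC₂, h₂⟩ := exists_tsum_seqK_le hs hq hr hb
  obtain ⟨c, hc, h₃⟩ := exists_ofReal_mul_rpow_le hC₁ (one_div_pos.2 hr).le
  obtain ⟨C, hC, h₄⟩ := exists_rpow_le_ofReal_mul_rpow hC₂ (one_div_pos.2 hr).le
  exact ⟨c, C, hc, hC, fun x ↦
    ⟨h₃ _ _ (h₁ x), h₄ _ _ (h₂ x)⟩⟩
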